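/- If T is the complete binary tree of height h ≥ 2, then md(T) = 2^h − 1. -/

import Mathlib

open SimpleGraph

/-- The multiset of distances from `v` to the vertices of `W`. -/
noncomputable def mrep {V : Type*} (G : SimpleGraph V) (W : Finset V) (v : V) : Multiset ℕ :=
  W.val.map (fun w => G.dist v w)

/-- `W` is an m-resolving set of `G`: distinct vertices have distinct
representation multisets. -/
def IsMResolving {V : Type*} (G : SimpleGraph V) (W : Finset V) : Prop :=
  ∀ u v : V, u ≠ v → mrep G W u ≠ mrep G W v

/-- The multiset dimension of `G`, equal to `⊤` if `G` has no m-resolving set. -/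
noncomputable def mdim {V : Type*} (G : SimpleGraph V) : ℕ∞ :=
  ⨅ W : {W : Finset V // IsMResolving G W}, (W.1.card : ℕ∞)

/-- The complete `k`-ary tree of height `h`: vertices are lists over `Fin k` of
length at most `h` (the root is `[]`, children are obtained by prepending a
letter), so every non-leaf has exactly `k` children and all leaves are at
depth `h`. -/
def karyTree (k h : ℕ) : SimpleGraph {l : List (Fin k) // l.length ≤ h} :=
  SimpleGraph.fromRel (fun u v => ∃ a : Fin k, v.1 = a :: u.1)

open Polynomial in
theorem coeff_gen (M : Multiset ℕ) (n : ℕ) :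
    ((M.map (fun k => (X : ℤ[X]) ^ k)).sum).coeff n = (M.count n : ℤ) := by
  induction M using Multiset.induction_on with
  | empty => simp
  | cons a M ih =>
    rw [Multiset.map_cons, Multiset.sum_cons, coeff_add, ih, coeff_X_pow, Multiset.count_cons]
    push_cast
    ring

abbrev BV (h : ℕ) := {l : List (Fin 2) // l.length ≤ h}

theorem bt_adj {h : ℕ} {x y : BV h} (H : (karyTree 2 h).Adj x y) :
    (∃ a, y.1 = a :: x.1) ∨ (∃ a, x.1 = a :: y.1) := by
  unfold karyTree at H
  rw [SimpleGraph.fromRel_adj] at H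
  exact H.2

theorem bt_adj_cons {h : ℕ} {x y : BV h} (a : Fin 2) (H : y.1 = a :: x.1) :
    (karyTree 2 h).Adj x y := by
  unfold karyTree
  rw [SimpleGraph.fromRel_adj]
  refine ⟨?_, Or.inl ⟨a, H⟩⟩
  rintro rfl
  have := congrArg List.length H
  simp at this

theorem bt_walk {h : ℕ} (l : BV h) (s : List (Fin 2)) : ∀ (w : BV h), w.1 = s ++ l.1 →
    ∃ p : (karyTree 2 h).Walk l w, p.length = s.length := by
  induction s with
  | nil =>
    intro w hw
    have : w = l := Subtype.ext (by simpa using hw)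
    subst this
    exact ⟨.nil, rfl⟩
  | cons a s ih =>
    intro w hw
    have hlen := w.2
    rw [hw] at hlen
    obtain ⟨p, hp⟩ := ih ⟨s ++ l.1, by simp at hlen ⊢; omega⟩ rfl
    refine ⟨p.concat (bt_adj_cons a (by simpa using hw)), ?_⟩
    simp [hp]

theorem bt_conn (h : ℕ) : (karyTree 2 h).Connected := by
  have hr : ∀ w : BV h, (karyTree 2 h).Reachable ⟨[], by simp⟩ w := fun w => by
    obtain ⟨p, _⟩ := bt_walk (h := h) ⟨[], by simp⟩ w.1 w (by simp)
    exact ⟨p⟩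
  haveI : Nonempty (BV h) := ⟨⟨[], by simp⟩⟩
  exact ⟨fun u v => (hr u).symm.trans (hr v)⟩

theorem bt_len {h : ℕ} {x y : BV h} (p : (karyTree 2 h).Walk x y) :
    y.1.length ≤ x.1.length + p.length := by
  induction p with
  | nil => simp
  | cons H p ih =>
    rw [SimpleGraph.Walk.length_cons]
    rcases bt_adj H with ⟨a, e⟩ | ⟨a, e⟩ <;>
      (have := congrArg List.length e; simp at this; omega)

theorem bt_dist_suffix {h : ℕ} (l w : BV h) (H : l.1 <:+ w.1) :
    (karyTree 2 h).dist l w = w.1.length - l.1.length := by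
  obtain ⟨s, hs⟩ := H
  obtain ⟨p, hp⟩ := bt_walk l s w hs.symm
  obtain ⟨q, hq⟩ := (bt_conn h).exists_walk_length_eq_dist l w
  have h1 := bt_len q
  have h2 := SimpleGraph.dist_le p
  have h3 := congrArg List.length hs
  simp at h3
  omega

theorem bt_walk_out {h : ℕ} {u : BV h} {a : Fin 2} {x w : BV h} (p : (karyTree 2 h).Walk x w)
    (hx : (a :: u.1) <:+ x.1) (hw : ¬ (a :: u.1) <:+ w.1) :
    (karyTree 2 h).dist u w + x.1.length ≤ p.length + u.1.length := by
  induction p with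
  | nil => exact absurd hx hw
  | @cons x y z H p ih =>
    rw [SimpleGraph.Walk.length_cons]
    by_cases hy : (a :: u.1) <:+ y.1
    · have := ih hy hw
      rcases bt_adj H with ⟨b, e⟩ | ⟨b, e⟩
      · have := congrArg List.length e
        simp at this
        omega
      · have := congrArg List.length e
        simp at this
        omega
    · rcases bt_adj H with ⟨b, e⟩ | ⟨b, e⟩
      · exact absurd (e ▸ hx.trans (List.suffix_cons b _)) hy
      · rw [e, List.suffix_cons_iff] at hx
        rcases hx with hx | hx
        · have hu : u = y := Subtype.ext (by simpa using (List.cons.inj hx).2)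
          subst hu
          have := SimpleGraph.dist_le p
          have := congrArg List.length e
          simp at this
          omega
        · exact absurd hx hy

theorem bt_dist_out {h : ℕ} {u v : BV h} {a : Fin 2} (hv : v.1 = a :: u.1) (w : BV h)
    (hw : ¬ v.1 <:+ w.1) :
    (karyTree 2 h).dist v w = (karyTree 2 h).dist u w + 1 := by
  obtain ⟨q, hq⟩ := (bt_conn h).exists_walk_length_eq_dist v w
  have h1 := bt_walk_out (u := u) (a := a) q (by rw [hv]) (by rwa [← hv])
  have h2 := (bt_conn h).dist_triangle (u := v) (v := u) (w := w)
  have h3 : (karyTree 2 h).dist v u = 1 :=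
    SimpleGraph.dist_eq_one_iff_adj.2 (bt_adj_cons a hv).symm
  have h4 := congrArg List.length hv
  simp at h4
  omega

open Polynomial

/-- Generating polynomial of the distance multiset. -/
noncomputable def genR {h : ℕ} (W : Finset (BV h)) (v : BV h) : ℤ[X] :=
  ∑ w ∈ W, X ^ ((karyTree 2 h).dist v w)

/-- Generating polynomial of depths of `W` below `l`. -/
noncomputable def genS {h : ℕ} (W : Finset (BV h)) (l : List (Fin 2)) : ℤ[X] :=
  ∑ w ∈ W, if l <:+ w.1 then X ^ (w.1.length - l.length) else 0

/-- Indicator of membership of a word. -/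
noncomputable def ind {h : ℕ} (W : Finset (BV h)) (l : List (Fin 2)) : ℤ[X] :=
  ∑ w ∈ W, if w.1 = l then 1 else 0

/-- The generic profile of a subtree of height `n`, without its root. -/
noncomputable def polyQ : ℕ → ℤ[X]
  | 0 => 0
  | n + 1 => X * (1 + 2 * polyQ n)

theorem genR_eq_iff {h : ℕ} (W : Finset (BV h)) (u v : BV h) :
    mrep (karyTree 2 h) W u = mrep (karyTree 2 h) W v ↔ genR W u = genR W v := by
  have key : ∀ v, genR W v = ((mrep (karyTree 2 h) W v).map (fun k => (X : ℤ[X]) ^ k)).sum := by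
    intro v
    rw [mrep, Multiset.map_map]
    rfl
  constructor
  · intro H
    rw [key, key, H]
  · intro H
    rw [key, key] at H
    ext n
    have := congrArg (fun p => coeff p n) H
    simp only [coeff_gen] at this
    exact_mod_cast this

theorem genR_cons {h : ℕ} (W : Finset (BV h)) {u v : BV h} {a : Fin 2} (hv : v.1 = a :: u.1) :
    genR W v = X * genR W u + (1 - X ^ 2) * genS W v.1 := by
  unfold genR genS
  rw [Finset.mul_sum, Finset.mul_sum, ← Finset.sum_add_distrib]
  refine Finset.sum_congr rfl fun w _ => ?_
  split_ifs with hw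
  · have hu : u.1 <:+ w.1 := (by rw [hv]; exact List.suffix_cons a _ : u.1 <:+ v.1).trans hw
    rw [bt_dist_suffix v w hw, bt_dist_suffix u w hu]
    have h1 := hw.length_le
    have h2 : v.1.length = u.1.length + 1 := by rw [hv]; simp
    have h3 : w.1.length - u.1.length = (w.1.length - v.1.length) + 1 := by omega
    rw [h3]
    ring
  · rw [bt_dist_out hv w hw]
    ring

theorem genS_rec {h : ℕ} (W : Finset (BV h)) (l : List (Fin 2)) :
    genS W l = ind W l + X * (genS W (0 :: l) + genS W (1 :: l)) := by
  unfold genS ind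
  rw [← Finset.sum_add_distrib, Finset.mul_sum, ← Finset.sum_add_distrib]
  refine Finset.sum_congr rfl fun w _ => ?_
  by_cases hl : l <:+ w.1
  · obtain ⟨s, hs⟩ := hl
    rw [← hs]
    rcases List.eq_nil_or_concat s with rfl | ⟨t, a, rfl⟩
    · have : ∀ a : Fin 2, ¬ (a :: l) <:+ l := fun a H => by
        have := H.length_le
        simp at this
      simp [this]
    · have e : ∀ b : Fin 2, (b :: l) <:+ (t ++ [a] ++ l) ↔ b = a := by
        intro b
        constructor
        · intro H
          have h2 : (a :: l) <:+ (t ++ [a] ++ l) := ⟨t, by simp⟩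
          have := List.suffix_of_suffix_length_le H h2 (by simp)
          have := this.eq_of_length (by simp)
          exact (List.cons.inj this).1
        · rintro rfl
          exact ⟨t, by simp⟩
      have e2 : (t ++ [a] ++ l) ≠ l := fun H => by
        have := congrArg List.length H
        simp at this
        omega
      have e3 : l <:+ (t ++ [a] ++ l) := ⟨_, rfl⟩
      have e4 : (t ++ [a] ++ l).length - l.length = t.length + 1 := by simp; omega
      have e5 : ∀ b : Fin 2, (t ++ [a] ++ l).length - (b :: l).length = t.length := by
        intro b; simp
      rw [List.concat_eq_append]
      simp only [e, e2, e3, e4, e5, if_true, if_false]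
      fin_cases a <;> simp <;> ring
  · have : ∀ a : Fin 2, ¬ (a :: l) <:+ w.1 := fun a H => hl ((List.suffix_cons a l).trans H)
    have h2 : w.1 ≠ l := fun H => hl (by rw [H])
    simp [hl, this, h2]

theorem genS_long {h : ℕ} (W : Finset (BV h)) (l : List (Fin 2)) (hl : h < l.length) :
    genS W l = 0 := by
  refine Finset.sum_eq_zero fun w _ => if_neg fun H => ?_
  have := H.length_le
  have := w.2
  omega

theorem ind_cases {h : ℕ} (W : Finset (BV h)) (l : List (Fin 2)) :
    ind W l = 0 ∨ ind W l = 1 := by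
  unfold ind
  by_cases H : ∃ w ∈ W, w.1 = l
  · obtain ⟨w, hw, rfl⟩ := H
    right
    rw [Finset.sum_eq_single w]
    · simp
    · intro b _ hb
      rw [if_neg]
      exact fun H => hb (Subtype.ext H)
    · exact fun H => absurd hw H
  · left
    refine Finset.sum_eq_zero fun w hw => if_neg fun e => H ⟨w, hw, e⟩

theorem genS_eq {h : ℕ} (W : Finset (BV h))
    (hstep : ∀ u : List (Fin 2), u.length < h →
      genS W (0 :: u) - ind W (0 :: u) = genS W (1 :: u) - ind W (1 :: u) →
      ind W (0 :: u) + ind W (1 :: u) = 1) (n : ℕ) :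
    ∀ l : List (Fin 2), l.length + n = h → genS W l = ind W l + polyQ n := by
  induction n with
  | zero =>
    intro l hl
    rw [genS_rec, genS_long, genS_long] <;> simp [polyQ] <;> omega
  | succ n ih =>
    intro l hl
    have h0 := ih (0 :: l) (by simp; omega)
    have h1 := ih (1 :: l) (by simp; omega)
    have := hstep l (by omega) (by rw [h0, h1]; ring)
    rw [genS_rec, h0, h1, polyQ]
    linear_combination X * this

theorem polyQ_eval (n : ℕ) : (polyQ n).eval 1 = 2 ^ n - 1 := by
  induction n with
  | zero => simp [polyQ]
  | succ n ih =>
    simp [polyQ, ih]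
    ring

theorem polyQ_eval0 (n : ℕ) : (polyQ n).eval 0 = 0 := by
  cases n <;> simp [polyQ]

theorem polyQ_coeff (n : ℕ) : ∀ j, (polyQ n).coeff (j + 1) = if j < n then 2 ^ j else 0 := by
  induction n with
  | zero => simp [polyQ]
  | succ n ih =>
    intro j
    rw [polyQ, coeff_X_mul, coeff_add, two_mul, coeff_add]
    cases j with
    | zero =>
      have := polyQ_eval0 n
      rw [← coeff_zero_eq_eval_zero] at this
      simp [this]
    | succ j =>
      rw [ih]
      simp only [coeff_one]
      by_cases hj : j < n <;> simp [hj] <;> ring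

theorem genS_nil {h : ℕ} (W : Finset (BV h)) : (genS W []).eval 1 = W.card := by
  simp [genS, eval_finsetSum]

theorem genR_nil {h : ℕ} (W : Finset (BV h)) : genR W ⟨[], by simp⟩ = genS W [] := by
  unfold genR genS
  refine Finset.sum_congr rfl fun w _ => ?_
  rw [bt_dist_suffix _ _ (by simp)]
  simp

theorem bt_lower {h : ℕ} (W : Finset (BV h)) (hW : IsMResolving (karyTree 2 h) W) :
    2 ^ h - 1 ≤ W.card := by
  have key := genS_eq W (by
    intro u hu H
    have hne : genS W (0 :: u) ≠ genS W (1 :: u) := by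
      intro E
      refine hW ⟨0 :: u, by simpa using hu⟩ ⟨1 :: u, by simpa using hu⟩ (by simp) ?_
      rw [genR_eq_iff, genR_cons W (u := ⟨u, hu.le⟩) (v := ⟨0 :: u, by simpa using hu⟩) (a := 0) rfl,
        genR_cons W (u := ⟨u, hu.le⟩) (v := ⟨1 :: u, by simpa using hu⟩) (a := 1) rfl, E]
    rcases ind_cases W (0 :: u) with h0 | h0 <;> rcases ind_cases W (1 :: u) with h1 | h1
    · exact absurd (by simpa [h0, h1] using H) hne
    · simp [h0, h1]
    · simp [h0, h1]
    · exact absurd (by simpa [h0, h1] using H) hne) h [] (by simp)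
  have e := genS_nil W
  rw [key, eval_add, polyQ_eval] at e
  have h2 : (0 : ℤ) ≤ (ind W []).eval 1 := by
    rcases ind_cases W [] with h0 | h0 <;> simp [h0]
  have h3 : (2 : ℤ) ^ h - 1 ≤ W.card := by linarith
  have h4 : 1 ≤ 2 ^ h := Nat.one_le_two_pow
  zify [h4]
  exact h3

theorem bt_upper (h : ℕ) (hh : 2 ≤ h) :
    ∃ W : Finset (BV h), IsMResolving (karyTree 2 h) W ∧ W.card = 2 ^ h - 1 := by
  classical
  haveI : Finite (BV h) := List.finite_length_le (Fin 2) h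
  haveI : Fintype (BV h) := Fintype.ofFinite _
  let W : Finset (BV h) := Finset.univ.filter (fun w => ∃ u, w.1 = 0 :: u)
  have ind0 : ∀ u : List (Fin 2), u.length < h → ind W (0 :: u) = 1 := by
    intro u hu
    unfold ind
    rw [Finset.sum_eq_single ⟨0 :: u, by simpa using hu⟩]
    · simp
    · intro b _ hb
      rw [if_neg]
      exact fun H => hb (Subtype.ext H)
    · intro H
      simp [W] at H
  have ind1 : ∀ u : List (Fin 2), ind W (1 :: u) = 0 := by
    intro u
    refine Finset.sum_eq_zero fun w hw => if_neg fun e => ?_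
    simp [W, e] at hw
  have indn : ind W [] = 0 := by
    refine Finset.sum_eq_zero fun w hw => if_neg fun e => ?_
    simp [W, e] at hw
  have key := genS_eq W (by
    intro u hu _
    rw [ind0 u hu, ind1, add_zero])
  have keynil := key h [] (by simp)
  rw [indn, zero_add] at keynil
  refine ⟨W, ?_, ?_⟩
  · -- degree
    have hdeg : ∀ (l : List (Fin 2)) (hl : l.length ≤ h),
        (∀ n, h + l.length < n → (genR W ⟨l, hl⟩).coeff n = 0) ∧
        (genR W ⟨l, hl⟩).coeff (h + l.length) = if l = [] then 2 ^ (h - 1) else 2 ^ (h - 2) := by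
      obtain ⟨k, rfl⟩ : ∃ k, h = k + 2 := ⟨h - 2, by omega⟩
      intro l
      induction l with
      | nil =>
        intro hl
        rw [genR_nil, keynil]
        refine ⟨fun n hn => ?_, ?_⟩
        · obtain ⟨m, rfl⟩ : ∃ m, n = m + 1 := ⟨n - 1, by omega⟩
          rw [polyQ_coeff, if_neg]
          simp at hn
          omega
        · have := polyQ_coeff (k + 2) (k + 1)
          simpa using this
      | cons a u ih =>
        intro hl
        have hu : u.length + 1 ≤ k + 2 := by simpa using hl
        obtain ⟨i1, i2⟩ := ih (by omega)
        have hS := key (k + 2 - (u.length + 1)) (a :: u) (by simp; omega)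
        have hc : ∀ n, ((genR W ⟨a :: u, hl⟩)).coeff (n + 3) =
            (genR W ⟨u, by omega⟩).coeff (n + 2)
            + ((polyQ (k + 2 - (u.length + 1))).coeff (n + 3)
              - (polyQ (k + 2 - (u.length + 1))).coeff (n + 1)) - if n + 1 = 0 then 1 else 0 := by
          intro n
          rw [genR_cons W (u := ⟨u, by omega⟩) (v := ⟨a :: u, hl⟩) (a := a) rfl, hS]
          have : X * genR W ⟨u, by omega⟩ + (1 - X ^ 2) * (ind W (a :: u)
              + polyQ (k + 2 - (u.length + 1))) = X * genR W ⟨u, by omega⟩ +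
              (ind W (a :: u) - X ^ 2 * ind W (a :: u) + (polyQ (k + 2 - (u.length + 1)) -
              X ^ 2 * polyQ (k + 2 - (u.length + 1)))) := by ring
          rw [this]
          have e1 : ∀ p : ℤ[X], (X ^ 2 * p).coeff (n + 3) = p.coeff (n + 1) := fun p =>
            coeff_X_pow_mul p 2 (n + 1)
          rw [coeff_add, coeff_X_mul, coeff_add, coeff_sub, coeff_sub, e1, e1]
          rcases ind_cases W (a :: u) with h0 | h0 <;> simp [h0, coeff_one]
        constructor
        · intro n hn
          simp at hn
          obtain ⟨m, rfl⟩ : ∃ m, n = m + 3 := ⟨n - 3, by omega⟩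
          rw [hc, i1 _ (by omega), polyQ_coeff _ (m + 2), polyQ_coeff _ m, if_neg (by omega),
            if_neg (by omega)]
          simp
        · have e : k + 2 + (a :: u).length = (k + u.length) + 3 := by simp; omega
          have e2 : k + u.length + 2 = k + 2 + u.length := by omega
          rw [e, hc, polyQ_coeff _ (k + u.length + 2), polyQ_coeff _ (k + u.length),
            if_neg (by omega), e2, i2]
          cases u with
          | nil =>
            simp
            ring
          | cons b u => simp; omega
    -- equal length
    have heq : ∀ (l m : List (Fin 2)) (hl : l.length ≤ h) (hm : m.length ≤ h),
        l.length = m.length → genR W ⟨l, hl⟩ = genR W ⟨m, hm⟩ → l = m := by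
      intro l
      induction l with
      | nil =>
        intro m _ _ e _
        exact (List.length_eq_zero_iff.1 e.symm).symm
      | cons a u ih =>
        intro m hl hm e H
        cases m with
        | nil => simp at e
        | cons b v =>
          have hu : u.length + 1 ≤ h := by simpa using hl
          have e' : u.length = v.length := by simpa using e
          rw [genR_cons W (u := ⟨u, by omega⟩) (v := ⟨a :: u, hl⟩) (a := a) rfl,
            genR_cons W (u := ⟨v, by omega⟩) (v := ⟨b :: v, hm⟩) (a := b) rfl] at H
          dsimp only at H
          rw [key (h - (u.length + 1)) (a :: u) (by simp; omega),
            key (h - (u.length + 1)) (b :: v) (by simp; omega)] at H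
          have hi : ind W (a :: u) = ind W (b :: v) := by
            have := congrArg (eval 0) H
            rcases ind_cases W (a :: u) with h0 | h0 <;>
            rcases ind_cases W (b :: v) with h1 | h1 <;>
            simp [h0, h1, polyQ_eval0] at this ⊢
          rw [hi] at H
          have huv := ih v (by omega) (by omega) e' (mul_left_cancel₀ X_ne_zero (add_right_cancel H))
          subst huv
          have i0 := ind0 u (by omega)
          have i1 := ind1 u
          have hab : a = b := by
            fin_cases a <;> fin_cases b <;> simp [i0, i1] at hi ⊢
          rw [hab]
    intro u v huv H
    rw [genR_eq_iff] at H
    apply huv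
    obtain ⟨l, hl⟩ := u
    obtain ⟨m, hm⟩ := v
    have hp : ∀ l : List (Fin 2), (if l = [] then (2 : ℤ) ^ (h - 1) else 2 ^ (h - 2)) ≠ 0 := by
      intro l
      split_ifs <;> positivity
    refine Subtype.ext (heq l m hl hm ?_ H)
    rcases lt_trichotomy l.length m.length with hlt | hlt | hlt
    · have h1 := (hdeg l hl).1 (h + m.length) (by omega)
      rw [H, (hdeg m hm).2] at h1
      exact absurd h1 (hp m)
    · exact hlt
    · have h1 := (hdeg m hm).1 (h + l.length) (by omega)
      rw [← H, (hdeg l hl).2] at h1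
      exact absurd h1 (hp l)
  · have e := genS_nil W
    rw [keynil, polyQ_eval] at e
    have h4 : 1 ≤ 2 ^ h := Nat.one_le_two_pow
    zify [h4]
    exact e.symm

theorem stmt_15 (h : ℕ) (hh : 2 ≤ h) :
    mdim (karyTree 2 h) = ((2 ^ h - 1 : ℕ) : ℕ∞) := by
  unfold mdim
  apply le_antisymm
  · obtain ⟨W, hW, hc⟩ := bt_upper h hh
    exact (iInf_le _ ⟨W, hW⟩).trans (by rw [hc])
  · refine le_iInf fun W => ?_
    exact_mod_cast bt_lower W.1 W.2
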